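/- arXiv:2603.04100 — 2 statements merged into one kernel-verified Lean document; each statement's English description precedes it below -/
import Mathlib

section
/- Let G be a group acting on an abelian group A by group automorphisms, and let a ∈ A be such that d := 2a is fixed by every element of G. Then the following are equivalent: (i) there exists t ∈ A with 2t = 0 such that σ•a − a = σ•t − t for all σ ∈ G (the cocycle σ ↦ σ•a − a is a coboundary with values in A[2]); (ii) there exists a′ ∈ A fixed by every element of G with 2a′ = d. -/
/-- For `a` with `d := 2a` fixed by `G`, the cocycle `σ ↦ σ•a − a` is
a coboundary with values in `A[2]` iff there exists a `G`-fixed `a′` with `2a′ = d`. -/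
theorem stmt_5 {G A : Type*} [Group G] [AddCommGroup A] [DistribMulAction G A]
    (a : A) (hfix : ∀ σ : G, σ • (2 • a) = 2 • a) :
    (∃ t : A, 2 • t = 0 ∧ ∀ σ : G, σ • a - a = σ • t - t) ↔
      (∃ a' : A, (∀ σ : G, σ • a' = a') ∧ 2 • a' = 2 • a) := by
  constructor
  · rintro ⟨t, ht, h⟩
    refine ⟨a - t, fun σ => ?_, by rw [smul_sub, ht, sub_zero]⟩
    rw [smul_sub, sub_eq_sub_iff_sub_eq_sub]
    exact h σ
  · rintro ⟨a', h, h2⟩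
    refine ⟨a - a', by rw [smul_sub, h2, sub_self], fun σ => ?_⟩
    rw [smul_sub, h σ, sub_sub_sub_cancel_right]
end

section
/- Let G be a group, M a finite additive abelian group on which G acts by additive automorphisms, and X a nonempty set that is an additive torsor under M, with the G-action on X compatible with the torsor structure: σ•(m +ᵥ x) = (σ•m) +ᵥ (σ•x). Assume G acts transitively on M \ {0}, and assume there is a G-invariant subset Y ⊆ X whose cardinality satisfies 1 < |Y| < |X| − 1. Then no element of X is fixed by every element of G. -/
/-- If `G` acts transitively on the nonzero elements of `M`, then it acts transitively on the
complement of a fixed point in a torsor under `M` with a compatible `G`-action. -/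
theorem exists_smul_eq_of_forall_smul_eq {G M X : Type*} [Group G] [AddCommGroup M]
    [AddTorsor M X] [DistribMulAction G M] [MulAction G X]
    (hcompat : ∀ (σ : G) (m : M) (x : X), σ • (m +ᵥ x) = (σ • m) +ᵥ (σ • x))
    (htrans : ∀ m m' : M, m ≠ 0 → m' ≠ 0 → ∃ σ : G, σ • m = m')
    {x y z : X} (hx : ∀ σ : G, σ • x = x) (hy : y ≠ x) (hz : z ≠ x) :
    ∃ σ : G, σ • y = z := by
  obtain ⟨σ, hσ⟩ := htrans (y -ᵥ x) (z -ᵥ x) (vsub_ne_zero.2 hy) (vsub_ne_zero.2 hz)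
  refine ⟨σ, ?_⟩
  rw [← vsub_vadd y x, hcompat, hσ, hx, vsub_vadd]


/-- If `G` acts transitively on `M \ {0}` (`M` finite), `X` is a torsor
under `M` with a compatible `G`-action, and there is a `G`-invariant subset `Y ⊆ X`
with `1 < |Y| < |X| − 1`, then no element of `X` is `G`-fixed. -/
theorem stmt_7 {G M X : Type*} [Group G] [AddCommGroup M] [Finite M] [AddTorsor M X]
    [DistribMulAction G M] [MulAction G X]
    (hcompat : ∀ (σ : G) (m : M) (x : X), σ • (m +ᵥ x) = (σ • m) +ᵥ (σ • x))
    (htrans : ∀ m m' : M, m ≠ 0 → m' ≠ 0 → ∃ σ : G, σ • m = m')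
    (Y : Set X) (hYinv : ∀ σ : G, ∀ y ∈ Y, σ • y ∈ Y)
    (hY1 : 1 < Y.ncard) (hY2 : Y.ncard < Nat.card X - 1) :
    ¬ ∃ x : X, ∀ σ : G, σ • x = x := by
  rintro ⟨x, hx⟩
  obtain ⟨y, hyY, hyx⟩ := Set.exists_ne_of_one_lt_ncard hY1 x
  have : Finite X := Finite.of_equiv M (Equiv.vaddConst x)
  have hsub : {x}ᶜ ⊆ Y := by
    intro z hz
    obtain ⟨σ, rfl⟩ := exists_smul_eq_of_forall_smul_eq hcompat htrans hx hyx hz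
    exact hYinv σ y hyY
  have hcard := Set.ncard_le_ncard hsub
  rw [Set.ncard_compl, Set.ncard_singleton] at hcard
  exact hY2.not_ge hcard
end
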